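/- arXiv:2405.12001 — 2 statements merged into one kernel-verified Lean document; each statement's English description precedes it below -/
import Mathlib

section
/- Let Z, Z_mut, Z* : I → E be three assignments of task representations and let π be an L_z-Lipschitz policy family. Then |J(π, Z*) − J(π, Z)| ≤ (2 R_max L_z / (1−γ)²) · ∑_{i∈I} w_i · ( dist(Z(i), Z_mut(i)) + dist(Z_mut(i), Z*(i)) ). (Return bound in COMRL: the gap between the expected return under the learned representation Z and under the optimal representation Z* is controlled by the representation distances through any intermediate representation Z_mut.) -/
open scoped BigOperators

/-- Total variation distance between two PMFs on a finite type. -/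
noncomputable def DTV {α : Type*} [Fintype α] (p q : PMF α) : ℝ :=
  (1 / 2) * ∑ x, |(p x).toReal - (q x).toReal|

/-- The time-`t` state–action distribution of policy `π` in the MDP with transition
kernel `P` and initial state distribution `ρ₀`. -/
noncomputable def stateActionDist {S A : Type*} (π : S → PMF A) (P : S × A → PMF S)
    (ρ₀ : PMF S) : ℕ → PMF (S × A)
  | 0 => ρ₀.bind fun s => (π s).map fun a => (s, a)
  | (t + 1) => (stateActionDist π P ρ₀ t).bind fun sa =>
      (P sa).bind fun s' => (π s').map fun a' => (s', a')

/-- The expected discounted return of policy `π` under transition kernel `P`,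
initial distribution `ρ₀`, discount `γ` and reward `R`. -/
noncomputable def Vret {S A : Type*} [Fintype S] [Fintype A] (π : S → PMF A)
    (P : S × A → PMF S) (ρ₀ : PMF S) (γ : ℝ) (R : S × A → ℝ) : ℝ :=
  ∑' t : ℕ, γ ^ t * ∑ sa : S × A, ((stateActionDist π P ρ₀ t) sa).toReal * R sa

/-- The task-averaged expected return of policy family `π` conditioned on the
task representation assignment `ζ`. -/
noncomputable def Jret {S A E I : Type*} [Fintype S] [Fintype A] [Fintype I]
    (π : S → E → PMF A) (ζ : I → E) (P : I → S × A → PMF S) (R : I → S × A → ℝ)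
    (ρ₀ : PMF S) (γ : ℝ) (w : I → ℝ) : ℝ :=
  ∑ i, w i * Vret (fun s => π s (ζ i)) (P i) ρ₀ γ (R i)

theorem PMF.sum_toReal_eq_one {α : Type*} [Fintype α] (p : PMF α) :
    ∑ x, (p x).toReal = 1 := by
  rw [← ENNReal.toReal_sum fun x _ => p.apply_ne_top x, ← tsum_fintype (L := .unconditional _),
    p.tsum_coe, ENNReal.toReal_one]

theorem PMF.toReal_bind_apply {α β : Type*} [Fintype α] (p : PMF α) (f : α → PMF β) (y : β) :
    (p.bind f y).toReal = ∑ x, (p x).toReal * (f x y).toReal := by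
  rw [PMF.bind_apply, tsum_fintype, ENNReal.toReal_sum
    fun x _ => ENNReal.mul_ne_top (p.apply_ne_top x) ((f x).apply_ne_top y)]
  simp only [ENNReal.toReal_mul]

theorem DTV_self {α : Type*} [Fintype α] (p : PMF α) : DTV p p = 0 := by
  simp [DTV]

theorem DTV_bind_le {α β : Type*} [Fintype α] [Fintype β] (p q : PMF α) (f g : α → PMF β)
    {δ : ℝ} (h : ∀ x, DTV (f x) (g x) ≤ δ) :
    DTV (p.bind f) (q.bind g) ≤ DTV p q + δ := by
  have pointwise (y : β) : |(p.bind f y).toReal - (q.bind g y).toReal| ≤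
      ∑ x, (|(p x).toReal - (q x).toReal| * (f x y).toReal +
        (q x).toReal * |(f x y).toReal - (g x y).toReal|) := by
    rw [PMF.toReal_bind_apply, PMF.toReal_bind_apply, ← Finset.sum_sub_distrib]
    refine (Finset.abs_sum_le_sum_abs _ _).trans (Finset.sum_le_sum fun x _ => ?_)
    calc
      _ = |((p x).toReal - (q x).toReal) * (f x y).toReal +
            (q x).toReal * ((f x y).toReal - (g x y).toReal)| := by ring_nf
      _ ≤ _ := by
        refine (abs_add_le _ _).trans_eq ?_
        rw [abs_mul, abs_mul, abs_of_nonneg (ENNReal.toReal_nonneg (a := f x y)),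
          abs_of_nonneg (ENNReal.toReal_nonneg (a := q x))]
  have total : ∑ y, |(p.bind f y).toReal - (q.bind g y).toReal| ≤
      ∑ x, |(p x).toReal - (q x).toReal| + 2 * δ := by
    refine (Finset.sum_le_sum fun y _ => pointwise y).trans ?_
    rw [Finset.sum_comm]
    simp only [Finset.sum_add_distrib, ← Finset.mul_sum, PMF.sum_toReal_eq_one, mul_one]
    gcongr
    calc
      _ ≤ ∑ x, (q x).toReal * (2 * δ) := by
        refine Finset.sum_le_sum fun x _ =>
          mul_le_mul_of_nonneg_left ?_ ENNReal.toReal_nonneg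
        have := h x
        unfold DTV at this
        linarith
      _ = 2 * δ := by rw [← Finset.sum_mul, PMF.sum_toReal_eq_one, one_mul]
  unfold DTV
  linarith

theorem DTV_map_le {α β : Type*} [Fintype α] [Fintype β] (p q : PMF α) (f : α → β) :
    DTV (p.map f) (q.map f) ≤ DTV p q := by
  simpa [PMF.map] using DTV_bind_le p q (PMF.pure ∘ f) (PMF.pure ∘ f) fun x => (DTV_self _).le

theorem DTV_stateActionDist_le {S A : Type*} [Fintype S] [Fintype A] (π π' : S → PMF A)
    (P : S × A → PMF S) (ρ₀ : PMF S) {δ : ℝ} (h : ∀ s, DTV (π s) (π' s) ≤ δ) (t : ℕ) :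
    DTV (stateActionDist π P ρ₀ t) (stateActionDist π' P ρ₀ t) ≤ (t + 1) * δ := by
  have step (μ : PMF S) : DTV (μ.bind fun s => (π s).map fun a => (s, a))
      (μ.bind fun s => (π' s).map fun a => (s, a)) ≤ δ := by
    simpa [DTV_self] using DTV_bind_le μ μ _ _ fun s => (DTV_map_le (π s) (π' s) _).trans (h s)
  induction t with
  | zero => simpa [stateActionDist] using step ρ₀
  | succ t ih =>
    have := DTV_bind_le (stateActionDist π P ρ₀ t) (stateActionDist π' P ρ₀ t) _ _
      fun sa => step (P sa)
    simp only [stateActionDist]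
    push_cast
    linarith

theorem abs_sum_toReal_mul_le {α : Type*} [Fintype α] (p : PMF α) {R : α → ℝ} {C : ℝ}
    (hR : ∀ x, |R x| ≤ C) : |∑ x, (p x).toReal * R x| ≤ C := by
  calc
    _ ≤ ∑ x, (p x).toReal * C := by
      refine (Finset.abs_sum_le_sum_abs _ _).trans (Finset.sum_le_sum fun x _ => ?_)
      rw [abs_mul, abs_of_nonneg ENNReal.toReal_nonneg]
      exact mul_le_mul_of_nonneg_left (hR x) ENNReal.toReal_nonneg
    _ = C := by rw [← Finset.sum_mul, PMF.sum_toReal_eq_one, one_mul]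

theorem abs_sum_toReal_mul_sub_le {α : Type*} [Fintype α] (p q : PMF α) {R : α → ℝ} {C : ℝ}
    (hR : ∀ x, |R x| ≤ C) :
    |∑ x, (p x).toReal * R x - ∑ x, (q x).toReal * R x| ≤ 2 * C * DTV p q := by
  rw [← Finset.sum_sub_distrib]
  calc
    _ ≤ ∑ x, |(p x).toReal - (q x).toReal| * C := by
      refine (Finset.abs_sum_le_sum_abs _ _).trans (Finset.sum_le_sum fun x _ => ?_)
      rw [← sub_mul, abs_mul]
      exact mul_le_mul_of_nonneg_left (hR x) (abs_nonneg _)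
    _ = 2 * C * DTV p q := by rw [← Finset.sum_mul, DTV]; ring

theorem summable_discounted_reward {S A : Type*} [Fintype S] [Fintype A] (π : S → PMF A)
    (P : S × A → PMF S) (ρ₀ : PMF S) {γ : ℝ} (hγ0 : 0 ≤ γ) (hγ1 : γ < 1) {R : S × A → ℝ} {C : ℝ}
    (hR : ∀ sa, |R sa| ≤ C) :
    Summable fun t : ℕ =>
      γ ^ t * ∑ sa : S × A, ((stateActionDist π P ρ₀ t) sa).toReal * R sa := by
  refine Summable.of_norm_bounded ((summable_geometric_of_lt_one hγ0 hγ1).mul_right C) fun t => ?_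
  rw [Real.norm_eq_abs, abs_mul, abs_of_nonneg (pow_nonneg hγ0 t)]
  exact mul_le_mul_of_nonneg_left (abs_sum_toReal_mul_le _ hR) (pow_nonneg hγ0 t)

theorem abs_Vret_sub_le {S A : Type*} [Fintype S] [Fintype A] (π π' : S → PMF A)
    (P : S × A → PMF S) (ρ₀ : PMF S) {γ : ℝ} (hγ0 : 0 ≤ γ) (hγ1 : γ < 1) {R : S × A → ℝ} {C : ℝ}
    (hC : 0 ≤ C) (hR : ∀ sa, |R sa| ≤ C) {δ : ℝ} (h : ∀ s, DTV (π s) (π' s) ≤ δ) :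
    |Vret π P ρ₀ γ R - Vret π' P ρ₀ γ R| ≤ 2 * C * δ / (1 - γ) ^ 2 := by
  have geom : HasSum (fun t : ℕ => 2 * C * δ * (((t : ℝ) + 1) * γ ^ t))
      (2 * C * δ / (1 - γ) ^ 2) := by
    have := (hasSum_choose_mul_geometric_of_norm_lt_one 1
      (by rwa [Real.norm_of_nonneg hγ0] : ‖γ‖ < 1)).mul_left (2 * C * δ)
    simpa [div_eq_mul_inv] using this
  rw [Vret, Vret, ← (summable_discounted_reward π P ρ₀ hγ0 hγ1 hR).tsum_sub
    (summable_discounted_reward π' P ρ₀ hγ0 hγ1 hR), ← Real.norm_eq_abs]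
  refine tsum_of_norm_bounded geom fun t => ?_
  rw [← mul_sub, Real.norm_eq_abs, abs_mul, abs_of_nonneg (pow_nonneg hγ0 t)]
  calc
    _ ≤ γ ^ t * (2 * C * ((t + 1) * δ)) := by
      refine mul_le_mul_of_nonneg_left ((abs_sum_toReal_mul_sub_le _ _ hR).trans ?_)
        (pow_nonneg hγ0 t)
      exact mul_le_mul_of_nonneg_left (DTV_stateActionDist_le π π' P ρ₀ h t) (by positivity)
    _ = _ := by ring

/-- **Return bound in COMRL** (Theorem 2). -/
theorem return_bound_COMRL
    {S A : Type*} [Fintype S] [Nonempty S] [Fintype A] [Nonempty A]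
    {E : Type*} [MetricSpace E] {I : Type*} [Fintype I]
    (ρ₀ : PMF S) (γ : ℝ) (hγ0 : 0 ≤ γ) (hγ1 : γ < 1)
    (w : I → ℝ) (hw0 : ∀ i, 0 ≤ w i) (hw1 : ∑ i, w i = 1)
    (P : I → S × A → PMF S) (R : I → S × A → ℝ)
    (Rmax : ℝ) (hRmax : 0 ≤ Rmax) (hR : ∀ i sa, |R i sa| ≤ Rmax)
    (Lz : ℝ) (hLz : 0 ≤ Lz)
    (π : S → E → PMF A)
    (hLip : ∀ s z z', DTV (π s z) (π s z') ≤ Lz * dist z z')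
    (Z Zmut Zstar : I → E) :
    |Jret π Zstar P R ρ₀ γ w - Jret π Z P R ρ₀ γ w| ≤
      2 * Rmax * Lz / (1 - γ) ^ 2 *
        ∑ i, w i * (dist (Z i) (Zmut i) + dist (Zmut i) (Zstar i)) := by
  rw [Jret, Jret, ← Finset.sum_sub_distrib, Finset.mul_sum]
  refine (Finset.abs_sum_le_sum_abs _ _).trans (Finset.sum_le_sum fun i _ => ?_)
  have hdist : dist (Zstar i) (Z i) ≤ dist (Z i) (Zmut i) + dist (Zmut i) (Zstar i) := by
    rw [dist_comm]
    exact dist_triangle _ _ _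
  rw [← mul_sub, abs_mul, abs_of_nonneg (hw0 i)]
  calc
    _ ≤ w i * (2 * Rmax *
          (Lz * (dist (Z i) (Zmut i) + dist (Zmut i) (Zstar i))) / (1 - γ) ^ 2) := by
      refine mul_le_mul_of_nonneg_left ?_ (hw0 i)
      exact abs_Vret_sub_le _ _ (P i) ρ₀ hγ0 hγ1 hRmax (hR i) fun s =>
        (hLip s _ _).trans (mul_le_mul_of_nonneg_left hdist hLz)
    _ = _ := by ring
end

section
/- Let Z, M, X_b, X_t be random variables over finite types with joint probability mass function p. Assume (i) I(Z ; X_t | (M, X_b)) = 0 (Z is conditionally independent of the task-related component X_t given the task M and the behavior-related component X_b), and (ii) the interaction information is nonnegative, i.e., I(Z ; M) − I(Z ; M | X_b) ≥ 0. Then I(Z ; X_t | X_b) ≤ I(Z ; M). (Lower-bound half of the mutual-information sandwich for context-based offline meta-RL objectives.) -/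
open scoped BigOperators Classical

/-- Mutual information `I(u(ω); v(ω))` of two discrete random variables defined on a
finite sample space `Ω` with joint probability mass function `p`. Summands with zero
joint probability vanish since `Real.log 0 = 0` and `0 * x = 0`. -/
noncomputable def mi {Ω U V : Type*} [Fintype Ω] [Fintype U] [Fintype V]
    (p : Ω → ℝ) (u : Ω → U) (v : Ω → V) : ℝ :=
  ∑ a : U, ∑ b : V,
    (∑ ω, if u ω = a ∧ v ω = b then p ω else 0) *
      Real.log ((∑ ω, if u ω = a ∧ v ω = b then p ω else 0) /
        ((∑ ω, if u ω = a then p ω else 0) * (∑ ω, if v ω = b then p ω else 0)))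

/-- Conditional mutual information `I(u(ω); v(ω) | w(ω))` of discrete random variables
on a finite sample space `Ω` with joint probability mass function `p`. -/
noncomputable def cmi {Ω U V W : Type*} [Fintype Ω] [Fintype U] [Fintype V] [Fintype W]
    (p : Ω → ℝ) (u : Ω → U) (v : Ω → V) (w : Ω → W) : ℝ :=
  ∑ a : U, ∑ b : V, ∑ c : W,
    (∑ ω, if u ω = a ∧ v ω = b ∧ w ω = c then p ω else 0) *
      Real.log (((∑ ω, if w ω = c then p ω else 0) *
            ∑ ω, if u ω = a ∧ v ω = b ∧ w ω = c then p ω else 0) /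
        ((∑ ω, if u ω = a ∧ w ω = c then p ω else 0) *
          ∑ ω, if v ω = b ∧ w ω = c then p ω else 0))

/-- The mass that `p` gives to the event `E`. -/
noncomputable def eventMass {Ω : Type*} [Fintype Ω] (p : Ω → ℝ) (E : Ω → Prop) : ℝ :=
  ∑ ω, if E ω then p ω else 0

section

variable {Ω U V W T : Type*} [Fintype Ω] [Fintype U] [Fintype V] [Fintype W] [Fintype T]
  {p : Ω → ℝ}

theorem eventMass_nonneg (hp : ∀ ω, 0 ≤ p ω) (E : Ω → Prop) : 0 ≤ eventMass p E :=
  Finset.sum_nonneg fun ω _ => by split_ifs <;> simp [hp ω]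

theorem eventMass_mono (hp : ∀ ω, 0 ≤ p ω) {E F : Ω → Prop} (h : ∀ ω, E ω → F ω) :
    eventMass p E ≤ eventMass p F := by
  refine Finset.sum_le_sum fun ω _ => ?_
  by_cases hE : E ω
  · simp [hE, h ω hE]
  · by_cases hF : F ω <;> simp [hE, hF, hp ω]

theorem eventMass_pos (hp : ∀ ω, 0 ≤ p ω) {E : Ω → Prop} {ω : Ω} (hω : 0 < p ω) (hE : E ω) :
    0 < eventMass p E := by
  refine Finset.sum_pos' (fun η _ => ?_) ⟨ω, Finset.mem_univ ω, by simpa [hE] using hω⟩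
  split_ifs <;> simp [hp η]

theorem sum_eventMass_eq_and (p : Ω → ℝ) (u : Ω → U) (E : Ω → Prop) :
    ∑ a, eventMass p (fun ω => u ω = a ∧ E ω) = eventMass p E := by
  simp only [eventMass]
  rw [Finset.sum_comm]
  refine Finset.sum_congr rfl fun ω _ => ?_
  by_cases h : E ω <;> simp [h]

theorem cmi_eq_sum_eventMass (p : Ω → ℝ) (u : Ω → U) (v : Ω → V) (w : Ω → W) :
    cmi p u v w = ∑ a, ∑ b, ∑ c, eventMass p (fun ω => u ω = a ∧ v ω = b ∧ w ω = c) *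
      Real.log ((eventMass p (fun ω => w ω = c) *
          eventMass p (fun ω => u ω = a ∧ v ω = b ∧ w ω = c)) /
        (eventMass p (fun ω => u ω = a ∧ w ω = c) *
          eventMass p (fun ω => v ω = b ∧ w ω = c))) := by
  simp only [cmi, eventMass]
  congr!

theorem sum_eventMass_mul (p : Ω → ℝ) (u : Ω → U) (v : Ω → V) (w : Ω → W)
    (f : U → V → W → ℝ) :
    ∑ a, ∑ b, ∑ c, eventMass p (fun ω => u ω = a ∧ v ω = b ∧ w ω = c) * f a b c =
      ∑ ω, p ω * f (u ω) (v ω) (w ω) := by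
  have hcollapse : ∀ ω, ∑ a, ∑ b, ∑ c,
      (if u ω = a ∧ v ω = b ∧ w ω = c then p ω else 0) * f a b c =
        p ω * f (u ω) (v ω) (w ω) := by
    intro ω
    simp [ite_and]
  simp only [← hcollapse, eventMass, Finset.sum_mul]
  simp only [Finset.sum_comm (s := (Finset.univ : Finset Ω))]
  congr!

/-- Conditional mutual information as the expectation of a log-likelihood ratio. -/
theorem cmi_eq_sum (p : Ω → ℝ) (u : Ω → U) (v : Ω → V) (w : Ω → W) :
    cmi p u v w = ∑ ω, p ω *
      Real.log ((eventMass p (fun η => w η = w ω) *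
          eventMass p (fun η => u η = u ω ∧ v η = v ω ∧ w η = w ω)) /
        (eventMass p (fun η => u η = u ω ∧ w η = w ω) *
          eventMass p (fun η => v η = v ω ∧ w η = w ω))) := by
  rw [cmi_eq_sum_eventMass]
  exact sum_eventMass_mul p u v w fun a b c =>
    Real.log ((eventMass p (fun ω => w ω = c) *
        eventMass p (fun ω => u ω = a ∧ v ω = b ∧ w ω = c)) /
      (eventMass p (fun ω => u ω = a ∧ w ω = c) * eventMass p (fun ω => v ω = b ∧ w ω = c)))

theorem sub_div_le_mul_log {a b c q : ℝ} (ha : 0 ≤ a) (hb : 0 ≤ b) (hq : 0 ≤ q)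
    (hqa : q ≤ a) (hqb : q ≤ b) (hqc : q ≤ c) :
    q - a * b / c ≤ q * Real.log (c * q / (a * b)) := by
  rcases hq.eq_or_lt with rfl | hq
  · have : 0 ≤ a * b / c := by positivity
    simpa using this
  · have ha : 0 < a := hq.trans_le hqa
    have hb : 0 < b := hq.trans_le hqb
    have hc : 0 < c := hq.trans_le hqc
    have h := Real.one_sub_inv_le_log_of_pos (x := c * q / (a * b)) (by positivity)
    calc q - a * b / c = q * (1 - (c * q / (a * b))⁻¹) := by field_simp
      _ ≤ _ := by gcongr

theorem cmi_nonneg (hp : ∀ ω, 0 ≤ p ω) (u : Ω → U) (v : Ω → V) (w : Ω → W) :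
    0 ≤ cmi p u v w := by
  have hsum : ∑ a, ∑ b, ∑ c, (eventMass p (fun ω => u ω = a ∧ v ω = b ∧ w ω = c) -
      eventMass p (fun ω => u ω = a ∧ w ω = c) * eventMass p (fun ω => v ω = b ∧ w ω = c) /
        eventMass p (fun ω => w ω = c)) = 0 := by
    have hswap : ∀ f : U → V → W → ℝ,
        ∑ a, ∑ b, ∑ c, f a b c = ∑ c, ∑ a, ∑ b, f a b c := by
      intro f
      rw [Finset.sum_comm (γ := W)]
      exact Finset.sum_congr rfl fun a _ => Finset.sum_comm
    rw [hswap]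
    refine Finset.sum_eq_zero fun c _ => ?_
    have hjoint : ∑ a, ∑ b, eventMass p (fun ω => u ω = a ∧ v ω = b ∧ w ω = c) =
        eventMass p (fun ω => w ω = c) := by
      rw [Finset.sum_comm]
      simp only [sum_eventMass_eq_and]
    simp only [Finset.sum_sub_distrib, hjoint, ← Finset.sum_div, ← Finset.mul_sum,
      ← Finset.sum_mul, sum_eventMass_eq_and, mul_self_div_self, sub_self]
  rw [cmi_eq_sum_eventMass, ← hsum]
  refine Finset.sum_le_sum fun a _ => Finset.sum_le_sum fun b _ => Finset.sum_le_sum fun c _ => ?_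
  exact sub_div_le_mul_log (eventMass_nonneg hp _) (eventMass_nonneg hp _)
    (eventMass_nonneg hp _) (eventMass_mono hp fun ω h => ⟨h.1, h.2.2⟩)
    (eventMass_mono hp fun ω h => h.2) (eventMass_mono hp fun ω h => h.2.2)

/-- The two chain-rule expansions of `I(u; (v, t) | w)` agree. -/
theorem cmi_add_cmi_comm (hp : ∀ ω, 0 ≤ p ω) (u : Ω → U) (v : Ω → V) (t : Ω → T) (w : Ω → W) :
    cmi p u t w + cmi p u v (fun ω => (t ω, w ω)) =
      cmi p u v w + cmi p u t (fun ω => (v ω, w ω)) := by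
  simp only [cmi_eq_sum, ← Finset.sum_add_distrib, ← mul_add, Prod.mk.injEq]
  refine Finset.sum_congr rfl fun ω _ => ?_
  rcases (hp ω).eq_or_lt with h | h
  · simp [← h]
  have hlog : ∀ {a b c d : ℝ}, 0 < a → 0 < b → 0 < c → 0 < d →
      Real.log (a * b / (c * d)) = Real.log a + Real.log b - (Real.log c + Real.log d) := by
    intro a b c d ha hb hc hd
    rw [Real.log_div (by positivity) (by positivity), Real.log_mul ha.ne' hb.ne',
      Real.log_mul hc.ne' hd.ne']
  rw [hlog, hlog, hlog, hlog]
  · simp only [and_left_comm (a := t _ = t ω) (b := v _ = v ω)]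
    ring
  all_goals exact eventMass_pos hp h (by simp)

end

/-- **Lower-bound half of the mutual-information sandwich** (Theorem 1):
if `I(Z; X_t | (M, X_b)) = 0` and the interaction information
`I(Z;M) − I(Z;M|X_b)` is nonnegative, then `I(Z; X_t | X_b) ≤ I(Z; M)`.
The sample space is `Ω = 𝒵 × ℳ × ℬ × 𝒯` with coordinates `Z, M, X_b, X_t`. -/
theorem mi_sandwich_lower
    {𝒵 ℳ ℬ 𝒯 : Type*} [Fintype 𝒵] [Fintype ℳ] [Fintype ℬ] [Fintype 𝒯]
    (p : 𝒵 × ℳ × ℬ × 𝒯 → ℝ) (hp0 : ∀ ω, 0 ≤ p ω) (hp1 : ∑ ω, p ω = 1)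
    (hcondindep :
      cmi p (fun ω => ω.1) (fun ω => ω.2.2.2) (fun ω => (ω.2.1, ω.2.2.1)) = 0)
    (hinteraction :
      0 ≤ mi p (fun ω => ω.1) (fun ω => ω.2.1) -
        cmi p (fun ω => ω.1) (fun ω => ω.2.1) (fun ω => ω.2.2.1)) :
    cmi p (fun ω => ω.1) (fun ω => ω.2.2.2) (fun ω => ω.2.2.1) ≤
      mi p (fun ω => ω.1) (fun ω => ω.2.1) := by
  have hchain := cmi_add_cmi_comm hp0 (fun ω => ω.1) (fun ω => ω.2.1) (fun ω => ω.2.2.2)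
    (fun ω => ω.2.2.1)
  have hnonneg := cmi_nonneg hp0 (fun ω => ω.1) (fun ω => ω.2.1)
    (fun ω => (ω.2.2.2, ω.2.2.1))
  linarith
end
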